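/- A(t_m)=0 for 0≤m≤2, and A(t_m)=(2t_{m-2}+t_{m-3}+3t_{m-4}−m−5)/2 for every m≥3. -/

import Mathlib

/-- The three-letter alphabet of the Tribonacci word. -/
inductive TLetter : Type
  | a | b | c
deriving DecidableEq

/-- The Tribonacci substitution σ(a)=ab, σ(b)=ac, σ(c)=a. -/
def tsubst : TLetter → List TLetter
  | .a => [.a, .b]
  | .b => [.a, .c]
  | .c => [.a]

/-- `Tword m = σ^m(a)`, the m-th finite Tribonacci word. -/
def Tword : ℕ → List TLetter
  | 0 => [.a]
  | n + 1 => (Tword n).flatMap tsubst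

/-- The prefix 𝕋[1,n] of the Tribonacci word of length n
(each `Tword n` is a prefix of the next and has length ≥ n). -/
def TPrefix (n : ℕ) : List TLetter := (Tword n).take n

/-- A word is a factor of the Tribonacci word 𝕋. -/
def IsFactorT (w : List TLetter) : Prop := ∃ m, w <:+: Tword m

/-- `tribAux i = t_{i-2}`: Tribonacci numbers, shifted so that the index is a natural. -/
def tribAux : ℕ → ℕ
  | 0 => 0
  | 1 => 1
  | 2 => 1
  | n + 3 => tribAux (n + 2) + tribAux (n + 1) + tribAux n

/-- The Tribonacci numbers `t m` for `m : ℤ`: t₋₂=0, t₋₁=1, t₀=1,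
`t m = t (m-1) + t (m-2) + t (m-3)` for m ≥ 1. (Junk value 0 below -2.) -/
def t (m : ℤ) : ℕ := tribAux (m + 2).toNat

/-- Kernel numbers: k₀=0, k₁=k₂=1, `k m = k (m-1) + k (m-2) + k (m-3) - 1` for m ≥ 3. -/
def kAux : ℕ → ℕ
  | 0 => 0
  | 1 => 1
  | 2 => 1
  | n + 3 => kAux (n + 2) + kAux (n + 1) + kAux n - 1

def kker (m : ℤ) : ℕ := kAux m.toNat

/-- `A n`: the number of distinct nonempty words w with ww a factor of 𝕋[1,n]. -/
noncomputable def A (n : ℕ) : ℕ := Nat.card {w : List TLetter // w ≠ [] ∧ (w ++ w) <:+: TPrefix n}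

/-- `B n`: the number of occurrences of squares in 𝕋[1,n], i.e. of pairs (w,i) with
w nonempty, i ≥ 1, ww occurring in 𝕋 at position i and i + 2|w| - 1 ≤ n. -/
noncomputable def B (n : ℕ) : ℕ :=
  Nat.card {p : List TLetter × ℕ // p.1 ≠ [] ∧ 1 ≤ p.2 ∧
    p.2 + 2 * p.1.length - 1 ≤ n ∧ (p.1 ++ p.1) <+: (TPrefix n).drop (p.2 - 1)}

/-- `C n`: the number of distinct nonempty words w with www a factor of 𝕋[1,n]. -/
noncomputable def C (n : ℕ) : ℕ := Nat.card {w : List TLetter // w ≠ [] ∧ (w ++ w ++ w) <:+: TPrefix n}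

/-- `D n`: the number of occurrences of cubes in 𝕋[1,n], i.e. of pairs (w,i) with
w nonempty, i ≥ 1, www occurring in 𝕋 at position i and i + 3|w| - 1 ≤ n. -/
noncomputable def D (n : ℕ) : ℕ :=
  Nat.card {p : List TLetter × ℕ // p.1 ≠ [] ∧ 1 ≤ p.2 ∧
    p.2 + 3 * p.1.length - 1 ≤ n ∧ (p.1 ++ p.1 ++ p.1) <+: (TPrefix n).drop (p.2 - 1)}

/-- The infinite Tribonacci word, indexed from `0`. -/
def tribWord (n : ℕ) : TLetter := (Tword n).getD n .a

/-- The factor of length `p` of the Tribonacci word starting at position `i`. -/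
def tribFactor (i p : ℕ) : List TLetter := (List.range p).map fun q => tribWord (i + q)

/-- The position where the image of the `n`-th letter starts when the substitution is applied
to the Tribonacci word. -/
def blockStart : ℕ → ℕ
  | 0 => 0
  | n + 1 => blockStart n + (tsubst (tribWord n)).length

/-- The length of `σ^k(s)`. -/
def substLen : ℕ → TLetter → ℕ
  | 0, _ => 1
  | k + 1, .a => substLen k .a + substLen k .b
  | k + 1, .b => substLen k .a + substLen k .c
  | k + 1, .c => substLen k .a

/-- The lengths of the bispecial prefixes `Y 0 = []`, `Y (k + 1) = σ(Y k) a`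
of the Tribonacci word. -/
def bispecialLen : ℕ → ℕ
  | 0 => 0
  | k + 1 => blockStart (bispecialLen k) + 1

theorem Tword_prefix_succ (k : ℕ) : Tword k <+: Tword (k + 1) := by
  induction k with
  | zero => exact ⟨[.b], rfl⟩
  | succ k ih =>
    obtain ⟨s, hs⟩ := ih
    refine ⟨s.flatMap tsubst, ?_⟩
    change (Tword k).flatMap tsubst ++ _ = (Tword (k + 1)).flatMap tsubst
    rw [← hs, List.flatMap_append]

theorem Tword_prefix {j k : ℕ} (h : j ≤ k) : Tword j <+: Tword k := by
  induction k, h using Nat.le_induction with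
  | base => exact List.prefix_rfl
  | succ k _ ih => exact ih.trans (Tword_prefix_succ k)

theorem length_le_length_flatMap_tsubst (l : List TLetter) :
    l.length ≤ (l.flatMap tsubst).length := by
  induction l with
  | nil => simp
  | cons s l ih =>
    rw [List.flatMap_cons, List.length_append, List.length_cons]
    have : 1 ≤ (tsubst s).length := by cases s <;> decide
    omega

theorem lt_length_Tword (k : ℕ) : k < (Tword k).length := by
  have key : ∀ k, ∃ l, Tword k = .a :: l ∧ k ≤ l.length := by
    intro k
    induction k with
    | zero => exact ⟨[], rfl, le_rfl⟩
    | succ k ih =>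
      obtain ⟨l, hl, hk⟩ := ih
      refine ⟨.b :: l.flatMap tsubst, by simp [Tword, hl, tsubst], ?_⟩
      have := length_le_length_flatMap_tsubst l
      simp only [List.length_cons]
      omega
  obtain ⟨l, hl, hk⟩ := key k
  rw [hl, List.length_cons]
  omega

theorem getElem_Tword {k n : ℕ} (h : n < (Tword k).length) : (Tword k)[n] = tribWord n := by
  have hn := lt_length_Tword n
  rw [tribWord, List.getD_eq_getElem _ _ hn]
  rcases le_total k n with hkn | hkn
  · exact (Tword_prefix hkn).getElem h
  · exact ((Tword_prefix hkn).getElem hn).symm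

@[simp] theorem length_tribFactor (i p : ℕ) : (tribFactor i p).length = p := by
  simp [tribFactor]

theorem tribFactor_eq_iff {i j p : ℕ} :
    tribFactor i p = tribFactor j p ↔ ∀ q < p, tribWord (i + q) = tribWord (j + q) := by
  simp [tribFactor, List.map_inj_left]

theorem tribFactor_add (i p q : ℕ) :
    tribFactor i (p + q) = tribFactor i p ++ tribFactor (i + p) q := by
  simp [tribFactor, List.range_add, Function.comp_def, add_assoc]

theorem tribFactor_one (i : ℕ) : tribFactor i 1 = [tribWord i] := by
  simp [tribFactor]

theorem tribFactor_two (i : ℕ) : tribFactor i 2 = [tribWord i, tribWord (i + 1)] := by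
  simp [tribFactor, List.range_succ]

theorem take_Tword {k n : ℕ} (h : n ≤ (Tword k).length) : (Tword k).take n = tribFactor 0 n := by
  apply List.ext_getElem
  · simpa using h
  · intro i h₁ h₂
    simp [tribFactor, getElem_Tword]

theorem TPrefix_eq (n : ℕ) : TPrefix n = tribFactor 0 n :=
  take_Tword (lt_length_Tword n).le

theorem flatMap_tribFactor (n : ℕ) :
    (tribFactor 0 n).flatMap tsubst = tribFactor 0 (blockStart n) := by
  have hlen : ((tribFactor 0 n).flatMap tsubst).length = blockStart n := by
    induction n with
    | zero => rfl
    | succ n ih => simp [tribFactor_add, tribFactor_one, blockStart, ih]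
  have hn := (lt_length_Tword n).le
  have hpre : (tribFactor 0 n).flatMap tsubst <+: Tword (n + 1) := by
    rw [← take_Tword hn]
    refine ⟨((Tword n).drop n).flatMap tsubst, ?_⟩
    rw [← List.flatMap_append, List.take_append_drop]
    rfl
  rw [List.prefix_iff_eq_take.mp hpre, hlen, take_Tword]
  exact hlen ▸ hpre.length_le

theorem tribFactor_blockStart (n : ℕ) :
    tribFactor (blockStart n) (tsubst (tribWord n)).length = tsubst (tribWord n) := by
  have h := flatMap_tribFactor (n + 1)
  rw [tribFactor_add, List.flatMap_append, flatMap_tribFactor, tribFactor_one, blockStart,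
    tribFactor_add] at h
  simpa using h.symm

theorem blockStart_of_a {n : ℕ} (h : tribWord n = .a) : blockStart (n + 1) = blockStart n + 2 := by
  simp [blockStart, h, tsubst]

theorem blockStart_of_b {n : ℕ} (h : tribWord n = .b) : blockStart (n + 1) = blockStart n + 2 := by
  simp [blockStart, h, tsubst]

theorem blockStart_of_c {n : ℕ} (h : tribWord n = .c) : blockStart (n + 1) = blockStart n + 1 := by
  simp [blockStart, h, tsubst]

theorem tribWord_blockStart (n : ℕ) : tribWord (blockStart n) = .a := by
  have h := tribFactor_blockStart n
  cases hn : tribWord n <;> simp_all [tsubst, tribFactor_one, tribFactor_two]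

theorem tribWord_blockStart_add_one_of_a {n : ℕ} (h : tribWord n = .a) :
    tribWord (blockStart n + 1) = .b := by
  have h' := tribFactor_blockStart n
  simp_all [tsubst, tribFactor_two]

theorem tribWord_blockStart_add_one_of_b {n : ℕ} (h : tribWord n = .b) :
    tribWord (blockStart n + 1) = .c := by
  have h' := tribFactor_blockStart n
  simp_all [tsubst, tribFactor_two]

theorem tribWord_blockStart_add_one_of_c {n : ℕ} (h : tribWord n = .c) :
    tribWord (blockStart n + 1) = .a := by
  rw [← blockStart_of_c h, tribWord_blockStart]

theorem tribWord_eq_of_blockStart {m n : ℕ}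
    (h : tribWord (blockStart m + 1) = tribWord (blockStart n + 1)) :
    tribWord m = tribWord n := by
  cases hm : tribWord m <;> cases hn : tribWord n <;>
    simp_all [tribWord_blockStart_add_one_of_a, tribWord_blockStart_add_one_of_b,
      tribWord_blockStart_add_one_of_c]

theorem blockStart_strictMono : StrictMono blockStart := by
  refine strictMono_nat_of_lt_succ fun n => ?_
  cases h : tribWord n
  · rw [blockStart_of_a h]; omega
  · rw [blockStart_of_b h]; omega
  · rw [blockStart_of_c h]; omega

theorem exists_blockStart (i : ℕ) :
    ∃ n, i = blockStart n ∨ i = blockStart n + 1 ∧ tribWord n ≠ .c := by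
  induction i with
  | zero => exact ⟨0, .inl rfl⟩
  | succ i ih =>
    obtain ⟨n, rfl | ⟨rfl, hn⟩⟩ := ih
    · by_cases h : tribWord n = .c
      · exact ⟨n + 1, .inl (blockStart_of_c h).symm⟩
      · exact ⟨n, .inr ⟨rfl, h⟩⟩
    · refine ⟨n + 1, .inl ?_⟩
      cases h : tribWord n
      · rw [blockStart_of_a h]
      · rw [blockStart_of_b h]
      · exact absurd h hn

theorem exists_blockStart_of_a {i : ℕ} (h : tribWord i = .a) : ∃ n, i = blockStart n := by
  obtain ⟨n, hn | ⟨rfl, hn⟩⟩ := exists_blockStart i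
  · exact ⟨n, hn⟩
  · cases h' : tribWord n
    · simp [tribWord_blockStart_add_one_of_a h'] at h
    · simp [tribWord_blockStart_add_one_of_b h'] at h
    · exact absurd h' hn

theorem exists_blockStart_of_ne_a {i : ℕ} (h : tribWord i ≠ .a) : ∃ n, i = blockStart n + 1 := by
  obtain ⟨n, rfl | ⟨rfl, -⟩⟩ := exists_blockStart i
  · exact absurd (tribWord_blockStart n) h
  · exact ⟨n, rfl⟩

theorem tribWord_succ_of_c {n : ℕ} (h : tribWord n = .c) : tribWord (n + 1) = .a := by
  obtain ⟨k, rfl⟩ := exists_blockStart_of_ne_a (i := n) (by simp [h])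
  cases hk : tribWord k
  · simp [tribWord_blockStart_add_one_of_a hk] at h
  · rw [add_assoc, ← blockStart_of_b hk, tribWord_blockStart]
  · simp [tribWord_blockStart_add_one_of_c hk] at h

theorem blockStart_add_three_le (n : ℕ) : blockStart n + 3 ≤ blockStart (n + 2) := by
  have h₁ : blockStart n < blockStart (n + 1) := blockStart_strictMono n.lt_succ_self
  have h₂ : blockStart (n + 1) < blockStart (n + 2) := blockStart_strictMono (n + 1).lt_succ_self
  cases h : tribWord n
  · rw [blockStart_of_a h] at h₂; omega
  · rw [blockStart_of_b h] at h₂; omega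
  · rw [blockStart_of_a (tribWord_succ_of_c h), blockStart_of_c h]

/-- Positions carrying equal letters have image blocks of equal lengths. -/
theorem blockStart_add_sub {m n j : ℕ} (h : ∀ q < j, tribWord (m + q) = tribWord (n + q)) :
    blockStart (m + j) + blockStart n = blockStart (n + j) + blockStart m := by
  induction j with
  | zero => simp [add_comm]
  | succ j ih =>
    have h₁ := ih fun q hq => h q (by omega)
    have h₂ := h j (by omega)
    rw [← add_assoc, ← add_assoc, blockStart, blockStart, h₂]
    omega

/-- Common factors of length `j` at `m` and `n` lift to common factors of length
`|σ(w)| + 1` at the starts of the image blocks. -/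
theorem tribWord_blockStart_add {m n j : ℕ}
    (h : ∀ q < j, tribWord (m + q) = tribWord (n + q)) :
    ∀ q ≤ blockStart (n + j) - blockStart n,
      tribWord (blockStart m + q) = tribWord (blockStart n + q) := by
  induction j with
  | zero =>
    intro q hq
    obtain rfl : q = 0 := by simpa using hq
    simp [tribWord_blockStart]
  | succ j ih =>
    intro q hq
    have ih := ih fun q hq => h q (by omega)
    have hj := h j (by omega)
    have hlen := blockStart_add_sub (m := m) (n := n) (j := j) fun q hq => h q (by omega)
    have hmn := blockStart_add_sub h
    have hn : blockStart n ≤ blockStart (n + j) := blockStart_strictMono.monotone (by omega)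
    have hm : blockStart m ≤ blockStart (m + j) := blockStart_strictMono.monotone (by omega)
    rcases le_or_gt q (blockStart (n + j) - blockStart n) with hq' | hq'
    · exact ih q hq'
    have hend : q = blockStart (n + (j + 1)) - blockStart n →
        tribWord (blockStart m + q) = tribWord (blockStart n + q) := by
      rintro rfl
      rw [show blockStart m + (blockStart (n + (j + 1)) - blockStart n)
          = blockStart (m + (j + 1)) by omega,
        show blockStart n + (blockStart (n + (j + 1)) - blockStart n)
          = blockStart (n + (j + 1)) by omega, tribWord_blockStart, tribWord_blockStart]
    have hmid : q = blockStart (n + j) + 1 - blockStart n → tribWord (n + j) ≠ .c →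
        tribWord (blockStart m + q) = tribWord (blockStart n + q) := by
      rintro rfl hc
      rw [show blockStart m + (blockStart (n + j) + 1 - blockStart n)
          = blockStart (m + j) + 1 by omega,
        show blockStart n + (blockStart (n + j) + 1 - blockStart n)
          = blockStart (n + j) + 1 by omega]
      cases h' : tribWord (n + j)
      · rw [tribWord_blockStart_add_one_of_a h', tribWord_blockStart_add_one_of_a (hj.trans h')]
      · rw [tribWord_blockStart_add_one_of_b h', tribWord_blockStart_add_one_of_b (hj.trans h')]
      · exact absurd h' hc
    rw [← add_assoc] at hq hend
    cases h' : tribWord (n + j)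
    · rw [blockStart_of_a h'] at hq hend
      by_cases hc : q = blockStart (n + j) + 1 - blockStart n
      · exact hmid hc (by simp [h'])
      · exact hend (by omega)
    · rw [blockStart_of_b h'] at hq hend
      by_cases hc : q = blockStart (n + j) + 1 - blockStart n
      · exact hmid hc (by simp [h'])
      · exact hend (by omega)
    · rw [blockStart_of_c h'] at hq hend
      exact hend (by omega)

/-- The bispecial prefix of order `k` occurs at the start of every image under `σ^k`
of a letter of the Tribonacci word. -/
theorem tribWord_iterate_add (k m : ℕ) :
    ∀ q < bispecialLen k, tribWord (blockStart^[k] m + q) = tribWord q := by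
  induction k with
  | zero => intro q hq; simp [bispecialLen] at hq
  | succ k ih =>
    intro q hq
    have h := tribWord_blockStart_add (m := blockStart^[k] m) (n := 0) (j := bispecialLen k)
      (by simpa using ih) q (by simp only [bispecialLen] at hq; simp [blockStart]; omega)
    simpa [Function.iterate_succ_apply', blockStart] using h

theorem iterate_blockStart_zero (k : ℕ) : blockStart^[k] 0 = 0 :=
  Function.iterate_fixed rfl k

theorem iterate_blockStart_succ (k m : ℕ) :
    blockStart^[k] (m + 1) = blockStart^[k] m + substLen k (tribWord m) := by
  induction k generalizing m with
  | zero => rfl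
  | succ k ih =>
    simp only [Function.iterate_succ_apply]
    cases h : tribWord m
    · rw [blockStart_of_a h, ih, ih, tribWord_blockStart, tribWord_blockStart_add_one_of_a h,
        substLen, add_assoc]
    · rw [blockStart_of_b h, ih, ih, tribWord_blockStart, tribWord_blockStart_add_one_of_b h,
        substLen, add_assoc]
    · rw [blockStart_of_c h, ih, tribWord_blockStart, substLen]

theorem substLen_eq (k : ℕ) :
    substLen k .a = tribAux (k + 2) ∧ substLen k .b = tribAux (k + 1) + tribAux k ∧
      substLen k .c = tribAux (k + 1) := by
  induction k with
  | zero => decide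
  | succ k ih =>
    obtain ⟨h₁, h₂, h₃⟩ := ih
    simp only [substLen, h₁, h₂, h₃, tribAux, and_true]
    omega

theorem substLen_pos (k : ℕ) (s : TLetter) : 0 < substLen k s := by
  induction k generalizing s with
  | zero => exact Nat.one_pos
  | succ k ih =>
    have := ih .a
    cases s <;> simp only [substLen] <;> omega

theorem tribWord_zero : tribWord 0 = .a := by decide
theorem tribWord_one : tribWord 1 = .b := by decide
theorem tribWord_two : tribWord 2 = .a := by decide
theorem tribWord_three : tribWord 3 = .c := by decide

theorem iterate_blockStart_one (k : ℕ) : blockStart^[k] 1 = tribAux (k + 2) := by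
  have h := iterate_blockStart_succ k 0
  rwa [iterate_blockStart_zero, tribWord_zero, (substLen_eq k).1, zero_add, zero_add] at h

theorem tribAux_add_three (n : ℕ) :
    tribAux (n + 3) = tribAux (n + 2) + tribAux (n + 1) + tribAux n := rfl

theorem iterate_blockStart_three (k : ℕ) :
    blockStart^[k] 3 + tribAux (k + 1) = tribAux (k + 4) := by
  have h₁ := iterate_blockStart_succ k 1
  have h₂ := iterate_blockStart_succ k 2
  rw [tribWord_one, (substLen_eq k).2.1, iterate_blockStart_one] at h₁
  rw [tribWord_two, (substLen_eq k).1] at h₂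
  norm_num only at h₁ h₂
  have h₃ := tribAux_add_three k
  have h₄ := tribAux_add_three (k + 1)
  norm_num only [add_assoc] at h₄
  omega

theorem bispecialLen_succ (k : ℕ) : bispecialLen (k + 1) = bispecialLen k + tribAux (k + 2) := by
  induction k with
  | zero => rfl
  | succ k ih =>
    have h := blockStart_add_sub (m := blockStart^[k] 1) (n := 0) (j := bispecialLen k)
      (by simpa using tribWord_iterate_add k 1)
    rw [← Function.iterate_succ_apply' blockStart, iterate_blockStart_one,
      iterate_blockStart_one, add_comm, zero_add] at h
    have h₁ : bispecialLen (k + 1) = blockStart (bispecialLen k) + 1 := rfl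
    have h₂ : bispecialLen (k + 2) = blockStart (bispecialLen (k + 1)) + 1 := rfl
    rw [ih, add_comm (bispecialLen k)] at h₂
    simp only [blockStart] at h
    change bispecialLen (k + 2) = bispecialLen (k + 1) + tribAux (k + 3)
    have h₃ : tribAux (k.succ + 2) = tribAux (k + 3) := rfl
    omega

theorem two_mul_bispecialLen (k : ℕ) :
    2 * bispecialLen k + 3 = tribAux (k + 3) + tribAux (k + 1) := by
  induction k with
  | zero => rfl
  | succ k ih =>
    have h₁ := tribAux_add_three k
    have h₂ := tribAux_add_three (k + 1)
    rw [bispecialLen_succ]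
    norm_num only [add_assoc] at h₂ ⊢
    omega

theorem tribAux_mono : Monotone tribAux := by
  refine monotone_nat_of_le_succ fun n => ?_
  match n with
  | 0 => decide
  | 1 => decide
  | n + 2 => simp only [tribAux]; omega

theorem tribAux_succ_pos (n : ℕ) : 0 < tribAux (n + 1) :=
  tribAux_mono (Nat.succ_le_succ n.zero_le)

/-- A repetition of period `p` that cannot be extended to the left and whose overlap has length
at least `p - 1` comes from a single letter by iterating the substitution. -/
theorem exists_iterate_of_left_maximal {j i p : ℕ} (hp : 0 < p) (hjp : p ≤ j + 1)
    (hleft : ∀ i', i = i' + 1 → tribWord i' ≠ tribWord (i' + p))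
    (h : ∀ q < j, tribWord (i + q) = tribWord (i + p + q)) :
    ∃ k m, i = blockStart^[k] m ∧ p = substLen k (tribWord m) ∧ j ≤ bispecialLen k := by
  induction j using Nat.strong_induction_on generalizing i p with
  | _ j ih =>
  rcases Nat.eq_zero_or_pos j with rfl | hj
  · exact ⟨0, i, rfl, by simp [substLen]; omega, Nat.zero_le _⟩
  have h₀ : tribWord i = tribWord (i + p) := h 0 hj
  have hia : tribWord i = .a := by
    by_contra hne
    obtain ⟨n, rfl⟩ := exists_blockStart_of_ne_a hne
    obtain ⟨n', hn'⟩ := exists_blockStart_of_ne_a (h₀ ▸ hne)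
    refine hleft _ rfl ?_
    rw [show blockStart n + p = blockStart n' by omega, tribWord_blockStart, tribWord_blockStart]
  obtain ⟨n, rfl⟩ := exists_blockStart_of_a hia
  obtain ⟨n', hn'⟩ := exists_blockStart_of_a (h₀ ▸ hia)
  obtain ⟨p', rfl⟩ : ∃ p', n' = n + p' := by
    refine ⟨n' - n, ?_⟩
    have : n < n' := blockStart_strictMono.lt_iff_lt.mp (by omega)
    omega
  have hp' : 0 < p' := by
    rcases Nat.eq_zero_or_pos p' with rfl | hpos
    · simp at hn'; omega
    · exact hpos
  have hgrow : ∀ q, blockStart n + q ≤ blockStart (n + q) := fun q => by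
    induction q with
    | zero => rfl
    | succ q ihq =>
      have : blockStart (n + q) < blockStart (n + (q + 1)) := blockStart_strictMono (by omega)
      omega
  have hex : ∃ j', blockStart n + j ≤ blockStart (n + j') + 1 :=
    ⟨j, by have := hgrow j; omega⟩
  obtain ⟨j', hj', hmin⟩ : ∃ j', blockStart n + j ≤ blockStart (n + j') + 1 ∧
      ∀ q < j', blockStart (n + q) + 1 < blockStart n + j := by
    classical
    exact ⟨Nat.find hex, Nat.find_spec hex, fun q hq => by
      have := Nat.find_min hex hq; omega⟩
  have hmatch : ∀ q < j', tribWord (n + q) = tribWord (n + p' + q) ∧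
      blockStart (n + p' + q) = blockStart (n + q) + p := by
    intro q
    induction q with
    | zero =>
      intro hq
      have h1 := hmin 0 hq
      have := h 1 (by simp at h1; omega)
      refine ⟨tribWord_eq_of_blockStart ?_, by simp; omega⟩
      rw [hn'] at this
      simpa using this
    | succ q ihq =>
      intro hq
      obtain ⟨e₁, e₂⟩ := ihq (by omega)
      have e₃ : blockStart (n + p' + (q + 1)) = blockStart (n + (q + 1)) + p := by
        rw [← add_assoc, ← add_assoc, blockStart, blockStart, e₁, e₂]
        omega
      refine ⟨tribWord_eq_of_blockStart ?_, e₃⟩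
      have h1 := hmin _ hq
      have h2 := hgrow (q + 1)
      have := h (blockStart (n + (q + 1)) + 1 - blockStart n) (by omega)
      rw [e₃]
      convert this using 2 <;> omega
  have hj'p' : p' ≤ j' + 1 := by
    by_contra hlt
    have h1 := blockStart_add_three_le (n + j')
    have h2 : blockStart (n + j' + 2) ≤ blockStart (n + p') :=
      blockStart_strictMono.monotone (by omega)
    omega
  have hlt : j' < j := by
    rcases Nat.eq_zero_or_pos j' with rfl | hpos
    · exact hj
    · have h1 := hmin (j' - 1) (by omega)
      have h2 := hgrow (j' - 1)
      omega
  have hleft' : ∀ i', n = i' + 1 → tribWord i' ≠ tribWord (i' + p') := by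
    rintro i' rfl heq
    obtain ⟨s, hs⟩ : ∃ s, blockStart (i' + 1) = s + 1 :=
      ⟨blockStart (i' + 1) - 1, by
        have : blockStart i' < blockStart (i' + 1) := blockStart_strictMono i'.lt_succ_self
        omega⟩
    refine hleft s hs ?_
    rw [show i' + 1 + p' = i' + p' + 1 by omega] at hn'
    cases hc : tribWord i'
    · have hc' := heq.symm.trans hc
      rw [blockStart_of_a hc] at hs hn'
      rw [blockStart_of_a hc'] at hn'
      rw [show s = blockStart i' + 1 by omega,
        show blockStart i' + 1 + p = blockStart (i' + p') + 1 by omega,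
        tribWord_blockStart_add_one_of_a hc, tribWord_blockStart_add_one_of_a hc']
    · have hc' := heq.symm.trans hc
      rw [blockStart_of_b hc] at hs hn'
      rw [blockStart_of_b hc'] at hn'
      rw [show s = blockStart i' + 1 by omega,
        show blockStart i' + 1 + p = blockStart (i' + p') + 1 by omega,
        tribWord_blockStart_add_one_of_b hc, tribWord_blockStart_add_one_of_b hc']
    · have hc' := heq.symm.trans hc
      rw [blockStart_of_c hc] at hs hn'
      rw [blockStart_of_c hc'] at hn'
      rw [show s = blockStart i' by omega,
        show blockStart i' + p = blockStart (i' + p') by omega,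
        tribWord_blockStart, tribWord_blockStart]
  obtain ⟨k, m, rfl, rfl, hk⟩ :=
    ih j' hlt hp' hj'p' hleft' fun q hq => (hmatch q hq).1
  refine ⟨k + 1, m, (Function.iterate_succ_apply' _ _ _).symm, ?_, ?_⟩
  · have h1 := iterate_blockStart_succ (k + 1) m
    rw [Function.iterate_succ_apply', Function.iterate_succ_apply',
      iterate_blockStart_succ] at h1
    omega
  · have h1 := blockStart_add_sub (m := blockStart^[k] m) (n := 0) (j := j') fun q hq => by
      simpa using tribWord_iterate_add k m q (by omega)
    have h2 : blockStart (0 + j') ≤ blockStart (bispecialLen k) :=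
      blockStart_strictMono.monotone (by omega)
    simp only [blockStart] at h1
    rw [bispecialLen]
    omega

theorem exists_left_maximal {i p j : ℕ}
    (h : ∀ q < j, tribWord (i + q) = tribWord (i + p + q)) :
    ∃ i₀ r, i = i₀ + r ∧ (∀ i', i₀ = i' + 1 → tribWord i' ≠ tribWord (i' + p)) ∧
      ∀ q < r + j, tribWord (i₀ + q) = tribWord (i₀ + p + q) := by
  induction i generalizing j with
  | zero => exact ⟨0, 0, rfl, by simp, by simpa using h⟩
  | succ i ih =>
    by_cases heq : tribWord i = tribWord (i + p)
    · obtain ⟨i₀, r, rfl, h₁, h₂⟩ := ih (j := j + 1) fun q hq => by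
        rcases q with _ | q
        · exact heq
        · convert h q (by omega) using 2 <;> omega
      exact ⟨i₀, r + 1, rfl, h₁, fun q hq => h₂ q (by omega)⟩
    · refine ⟨i + 1, 0, rfl, ?_, by simpa using h⟩
      rintro i' hi'
      obtain rfl : i = i' := by omega
      exact heq

/-- Every repetition with overlap at least its period lies in the repetition generated by
some letter of the Tribonacci word. -/
theorem exists_iterate_of_repetition {i p j : ℕ} (hp : 0 < p) (hjp : p ≤ j)
    (h : ∀ q < j, tribWord (i + q) = tribWord (i + p + q)) :
    ∃ k m r, i = blockStart^[k] m + r ∧ p = substLen k (tribWord m) ∧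
      r + j ≤ bispecialLen k := by
  obtain ⟨i₀, r, rfl, h₁, h₂⟩ := exists_left_maximal h
  obtain ⟨k, m, rfl, rfl, hk⟩ := exists_iterate_of_left_maximal hp (by omega) h₁ h₂
  exact ⟨k, m, r, rfl, rfl, hk⟩

/-- The nonempty words whose squares are factors of the prefix of length `N`. -/
def squareRoots (N : ℕ) : Set (List TLetter) := {w | w ≠ [] ∧ (w ++ w) <:+: TPrefix N}

theorem mem_squareRoots_iff {N : ℕ} {w : List TLetter} :
    w ∈ squareRoots N ↔ ∃ i p, 0 < p ∧ i + 2 * p ≤ N ∧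
      (∀ q < p, tribWord (i + q) = tribWord (i + p + q)) ∧ w = tribFactor i p := by
  rw [squareRoots, Set.mem_ofPred_eq, TPrefix_eq]
  constructor
  · rintro ⟨hw, s, u, hsu⟩
    have hlen := congrArg List.length hsu
    simp only [List.length_append, length_tribFactor] at hlen
    rw [show N = s.length + (w.length + (w.length + u.length)) by omega, tribFactor_add,
      tribFactor_add, tribFactor_add, List.append_assoc, List.append_assoc] at hsu
    obtain ⟨-, h⟩ := List.append_inj hsu (by simp)
    obtain ⟨h₁, h⟩ := List.append_inj h (by simp)
    obtain ⟨h₂, -⟩ := List.append_inj h (by simp)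
    rw [zero_add] at h₁ h₂
    exact ⟨s.length, w.length, List.length_pos_iff.mpr hw, by omega,
      tribFactor_eq_iff.mp (h₁.symm.trans h₂), h₁⟩
  · rintro ⟨i, p, hp, hN, h, rfl⟩
    refine ⟨fun h0 => by simpa [hp.ne'] using congrArg List.length h0, tribFactor 0 i,
      tribFactor (i + p + p) (N - (i + 2 * p)), ?_⟩
    obtain ⟨d, rfl⟩ := Nat.exists_eq_add_of_le hN
    rw [show i + 2 * p + d - (i + 2 * p) = d by omega,
      show i + 2 * p + d = i + (p + (p + d)) by omega,
      tribFactor_add, tribFactor_add, tribFactor_add, zero_add]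
    nth_rw 2 [tribFactor_eq_iff.mpr h]
    simp

theorem A_eq_ncard (N : ℕ) : A N = (squareRoots N).ncard := rfl

theorem tribFactor_mem_squareRoots {N k m r : ℕ}
    (hr : r + substLen k (tribWord m) ≤ bispecialLen k)
    (hN : blockStart^[k] m + r + 2 * substLen k (tribWord m) ≤ N) :
    tribFactor r (substLen k (tribWord m)) ∈ squareRoots N := by
  refine mem_squareRoots_iff.mpr ⟨_, _, substLen_pos _ _, hN, fun q hq => ?_, ?_⟩
  · rw [add_right_comm _ r (substLen _ _), ← iterate_blockStart_succ, add_assoc, add_assoc,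
      tribWord_iterate_add _ _ _ (by omega), tribWord_iterate_add _ _ _ (by omega)]
  · refine tribFactor_eq_iff.mpr fun q hq => ?_
    rw [add_assoc, tribWord_iterate_add _ _ _ (by omega)]

theorem exists_of_mem_squareRoots {N : ℕ} {w : List TLetter} (hw : w ∈ squareRoots N) :
    ∃ k m r, r + substLen k (tribWord m) ≤ bispecialLen k ∧
      blockStart^[k] m + r + 2 * substLen k (tribWord m) ≤ N ∧
      w = tribFactor r (substLen k (tribWord m)) := by
  obtain ⟨i, p, hp, hN, h, rfl⟩ := mem_squareRoots_iff.mp hw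
  obtain ⟨k, m, r, rfl, rfl, hr⟩ := exists_iterate_of_repetition hp le_rfl h
  refine ⟨k, m, r, hr, hN, tribFactor_eq_iff.mpr fun q hq => ?_⟩
  rw [add_assoc, tribWord_iterate_add _ _ _ (by omega)]

theorem tribAux_add_le (k : ℕ) : tribAux (k + 1) + tribAux k ≤ tribAux (k + 2) := by
  rcases k with _ | k
  · decide
  · have := tribAux_add_three k
    norm_num only [add_assoc] at this ⊢
    omega

theorem tribAux_succ_le (k : ℕ) : tribAux (k + 2) ≤ 2 * tribAux (k + 1) := by
  rcases k with _ | k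
  · decide
  · have h₁ := tribAux_add_three k
    have h₂ := tribAux_add_le k
    norm_num only [add_assoc] at h₁ h₂ ⊢
    omega

theorem tribAux_lt (k : ℕ) : tribAux (k + 2) < tribAux (k + 3) := by
  have h₁ := tribAux_add_three k
  have h₂ := tribAux_succ_pos k
  omega

theorem tribAux_add_two_strictMono : StrictMono fun k => tribAux (k + 2) :=
  strictMono_nat_of_lt_succ tribAux_lt

theorem tribAux_add_strictMono : StrictMono fun k => tribAux (k + 1) + tribAux k := by
  refine strictMono_nat_of_lt_succ fun k => ?_
  have h₁ := tribAux_add_le k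
  have h₂ := tribAux_succ_pos k
  norm_num only [add_assoc]
  omega

theorem bispecialLen_lt (k : ℕ) : bispecialLen k < 2 * (tribAux (k + 1) + tribAux k) := by
  have h₁ := two_mul_bispecialLen k
  have h₂ := tribAux_add_three k
  have h₃ := tribAux_succ_le k
  omega

theorem tribAux_le_bispecialLen (k : ℕ) : tribAux (k + 2) ≤ bispecialLen k + 1 := by
  induction k with
  | zero => decide
  | succ k ih =>
    have h₁ := bispecialLen_succ k
    have h₂ := tribAux_succ_le (k + 1)
    norm_num only [add_assoc] at h₂ ⊢
    omega

theorem tribAux_le_substLen (k : ℕ) (s : TLetter) : tribAux (k + 1) ≤ substLen k s := by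
  obtain ⟨h₁, h₂, h₃⟩ := substLen_eq k
  have := tribAux_mono (show k + 1 ≤ k + 2 by omega)
  cases s <;> omega

theorem not_substLen_between (k l : ℕ) (s : TLetter) (h₁ : tribAux (l + 1) < substLen k s)
    (h₂ : substLen k s < tribAux (l + 1) + tribAux l) : False := by
  obtain ⟨ha, hb, hc⟩ := substLen_eq k
  have h₃ := tribAux_add_le l
  have h₄ := tribAux_add_le k
  cases s
  · rw [ha] at h₁ h₂
    have := tribAux_mono.reflect_lt h₁
    have := tribAux_mono (show l + 2 ≤ k + 2 by omega)
    omega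
  · rw [hb] at h₁ h₂
    have : k < l := tribAux_add_strictMono.lt_iff_lt.mp h₂
    have := tribAux_mono (show k + 2 ≤ l + 1 by omega)
    omega
  · rw [hc] at h₁ h₂
    have := tribAux_mono.reflect_lt h₁
    have := tribAux_mono (show l + 2 ≤ k + 1 by omega)
    omega

theorem tribFactor_ne_of_lt {k m r r' : ℕ} (hr : r < r') (hp : r' < substLen k (tribWord m))
    (hD : r' + substLen k (tribWord m) ≤ bispecialLen k) :
    tribFactor r (substLen k (tribWord m)) ≠ tribFactor r' (substLen k (tribWord m)) := by
  intro heq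
  rw [tribFactor_eq_iff] at heq
  set p := substLen k (tribWord m) with hpdef
  have hocc₁ := tribWord_iterate_add k m
  have hocc₂ := tribWord_iterate_add k (m + 1)
  rw [iterate_blockStart_succ, ← hpdef] at hocc₂
  obtain ⟨d, rfl⟩ := Nat.exists_eq_add_of_lt hr
  obtain ⟨l, m', r'', -, hδ, hl⟩ := exists_iterate_of_repetition (i := blockStart^[k] m + r)
    (p := d + 1) (j := 2 * p) (by omega) (by omega) fun q hq => by
      rcases lt_or_ge q p with hqp | hqp
      · have e₁ := hocc₁ (r + q) (by omega)
        have e₂ := hocc₁ (r + d + 1 + q) (by omega)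
        have e₃ := heq q hqp
        rw [← e₁, ← e₂] at e₃
        convert e₃ using 2 <;> omega
      · have e₁ := hocc₂ (r + (q - p)) (by omega)
        have e₂ := hocc₂ (r + d + 1 + (q - p)) (by omega)
        have e₃ := heq (q - p) (by omega)
        rw [← e₁, ← e₂] at e₃
        convert e₃ using 2 <;> omega
  have h₁ := tribAux_le_substLen l (tribWord m')
  have h₂ := bispecialLen_lt l
  exact not_substLen_between k l (tribWord m) (by omega) (by omega)

theorem tribFactor_injOn {k m c : ℕ} (hp : c ≤ substLen k (tribWord m))
    (hD : c + substLen k (tribWord m) ≤ bispecialLen k + 1) :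
    Set.InjOn (fun r => tribFactor r (substLen k (tribWord m))) (Finset.range c) := by
  intro r hr r' hr' heq
  rw [Finset.mem_coe, Finset.mem_range] at hr hr'
  rcases lt_trichotomy r r' with h | h | h
  · exact absurd heq (tribFactor_ne_of_lt h (by omega) (by omega))
  · exact h
  · exact absurd heq.symm (tribFactor_ne_of_lt h (by omega) (by omega))

/-- The number of square roots of length `t k` in the prefix of length `t (n + 3)`. -/
def rootCountA (n k : ℕ) : ℕ :=
  if k < n then tribAux (k + 2) else bispecialLen k + 1 - tribAux (k + 2)

/-- The number of square roots of length `|σ^k(b)|` in the prefix of length `t (n + 3)`,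
for `k < n + 2`. -/
def rootCountB (k : ℕ) : ℕ := bispecialLen k + 1 - (tribAux (k + 1) + tribAux k)

/-- The square roots of length `t k` in the prefix of length `t (n + 3)`. -/
def rootsA (n k : ℕ) : Finset (List TLetter) :=
  (Finset.range (rootCountA n k)).image fun r => tribFactor r (tribAux (k + 2))

/-- The square roots of length `|σ^k(b)|` in the prefix of length `t (n + 3)`,
for `k < n + 2`. -/
def rootsB (k : ℕ) : Finset (List TLetter) :=
  (Finset.range (rootCountB k)).image fun r => tribFactor r (tribAux (k + 1) + tribAux k)

theorem rootCountA_le (n k : ℕ) : rootCountA n k ≤ tribAux (k + 2) := by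
  have h₁ := bispecialLen_lt k
  have h₂ := tribAux_add_le k
  rw [rootCountA]
  split <;> omega

theorem card_rootsA (n k : ℕ) : (rootsA n k).card = rootCountA n k := by
  have hlen : substLen (k + 1) (tribWord 3) = tribAux (k + 2) := by
    rw [tribWord_three, (substLen_eq _).2.2]
  have h₁ := rootCountA_le n k
  have h₂ := tribAux_le_bispecialLen k
  have h₃ := bispecialLen_succ k
  have hinj := tribFactor_injOn (k := k + 1) (m := 3) (c := rootCountA n k)
    (by omega) (by omega)
  rw [hlen] at hinj
  rw [rootsA, Finset.card_image_of_injOn hinj, Finset.card_range]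

theorem card_rootsB (k : ℕ) : (rootsB k).card = rootCountB k := by
  rcases Nat.eq_zero_or_pos (rootCountB k) with h | h
  · rw [rootsB, h]; rfl
  have hlen : substLen k (tribWord 1) = tribAux (k + 1) + tribAux k := by
    rw [tribWord_one, (substLen_eq _).2.1]
  have h₁ := bispecialLen_lt k
  have hinj := tribFactor_injOn (k := k) (m := 1) (c := rootCountB k)
    (by rw [rootCountB] at *; omega) (by rw [rootCountB] at *; omega)
  rw [hlen] at hinj
  rw [rootsB, Finset.card_image_of_injOn hinj, Finset.card_range]

theorem length_of_mem_rootsA {n k : ℕ} {w : List TLetter} (h : w ∈ rootsA n k) :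
    w.length = tribAux (k + 2) := by
  obtain ⟨r, -, rfl⟩ := Finset.mem_image.mp h
  simp

theorem length_of_mem_rootsB {k : ℕ} {w : List TLetter} (h : w ∈ rootsB k) :
    w.length = tribAux (k + 1) + tribAux k := by
  obtain ⟨r, -, rfl⟩ := Finset.mem_image.mp h
  simp

theorem disjoint_rootsA_rootsB (n k l : ℕ) : Disjoint (rootsA n k) (rootsB l) := by
  rw [Finset.disjoint_left]
  intro w hA hB
  have h := (length_of_mem_rootsA hA).symm.trans (length_of_mem_rootsB hB)
  match l with
  | 0 => simp [rootsB, rootCountB, bispecialLen, tribAux] at hB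
  | 1 => simp [rootsB, rootCountB, bispecialLen, blockStart, tribAux] at hB
  | l + 2 =>
    have h₁ := tribAux_add_three (l + 1)
    have h₂ := tribAux_succ_pos l
    have h₃ := tribAux_succ_pos (l + 1)
    norm_num only [add_assoc] at h h₁ h₂ h₃
    have h₄ : k + 2 < l + 4 := tribAux_mono.reflect_lt (by omega)
    have h₅ : l + 3 < k + 2 := tribAux_mono.reflect_lt (by omega)
    omega

theorem squareRoots_tribAux (n : ℕ) :
    squareRoots (tribAux (n + 5)) = ((Finset.range (n + 2)).biUnion (rootsA n) ∪
      (Finset.range (n + 2)).biUnion rootsB : Finset (List TLetter)) := by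
  have hn₂ := tribAux_add_three n
  have hn₃ := tribAux_add_three (n + 1)
  have hn₄ := tribAux_add_three (n + 2)
  have hn₅ := tribAux_succ_pos n
  norm_num only [add_assoc] at hn₂ hn₃ hn₄ hn₅
  ext w
  simp only [Finset.coe_union, Finset.coe_biUnion, Finset.mem_coe, Finset.mem_range,
    Set.mem_union, Set.mem_iUnion, exists_prop]
  constructor
  · intro hw
    obtain ⟨k, m, r, hr, hN, rfl⟩ := exists_of_mem_squareRoots hw
    obtain ⟨ha, hb, hc⟩ := substLen_eq k
    cases hs : tribWord m
    · rw [hs, ha] at hr hN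
      rw [ha]
      have hk : k < n + 2 := by
        by_contra hk
        have := tribAux_mono (show n + 4 ≤ k + 2 by omega)
        omega
      refine .inl ⟨k, hk, Finset.mem_image.mpr ⟨r, ?_, rfl⟩⟩
      have h₁ := bispecialLen_lt k
      have h₂ := tribAux_add_le k
      rw [Finset.mem_range, rootCountA]
      split <;> omega
    · rw [hs, hb] at hr hN
      rw [hb]
      have hm : 1 ≤ m := by
        rcases m with _ | m
        · simp [tribWord_zero] at hs
        · omega
      have hm := (blockStart_strictMono.iterate k).monotone hm
      rw [iterate_blockStart_one] at hm
      have hk : k < n + 2 := by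
        by_contra hk
        have := tribAux_mono (show n + 4 ≤ k + 2 by omega)
        have := tribAux_mono (show n + 3 ≤ k + 1 by omega)
        have := tribAux_mono (show n + 2 ≤ k by omega)
        omega
      refine .inr ⟨k, hk, Finset.mem_image.mpr ⟨r, ?_, rfl⟩⟩
      rw [Finset.mem_range, rootCountB]
      omega
    · rw [hs, hc] at hr hN
      rw [hc]
      have hm : 3 ≤ m := by
        by_contra hlt
        have : m = 0 ∨ m = 1 ∨ m = 2 := by omega
        rcases this with rfl | rfl | rfl
        · simp [tribWord_zero] at hs
        · simp [tribWord_one] at hs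
        · simp [tribWord_two] at hs
      have hm := (blockStart_strictMono.iterate k).monotone hm
      have h₃ := iterate_blockStart_three k
      have hpos := tribAux_succ_pos k
      obtain _ | k := k
      · simp only [bispecialLen] at hr
        omega
      have hk : k < n := by
        have := tribAux_mono.reflect_lt (show tribAux (k + 1 + 4) < tribAux (n + 5) by omega)
        omega
      have h₁ := bispecialLen_lt k
      have h₂ := tribAux_add_le k
      rw [bispecialLen_succ] at hr
      norm_num only [add_assoc] at hr ⊢
      refine .inl ⟨k, by omega, Finset.mem_image.mpr ?_⟩
      rw [rootCountA, if_pos hk]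
      rcases lt_or_ge r (tribAux (k + 2)) with hlt | hge
      · exact ⟨r, Finset.mem_range.mpr hlt, rfl⟩
      · obtain ⟨r, rfl⟩ := Nat.exists_eq_add_of_le hge
        refine ⟨r, Finset.mem_range.mpr (by omega), tribFactor_eq_iff.mpr fun q hq => ?_⟩
        rw [← iterate_blockStart_one, add_assoc, tribWord_iterate_add]
        omega
  · rintro (⟨k, hk, hw⟩ | ⟨k, hk, hw⟩)
    · obtain ⟨r, hr, rfl⟩ := Finset.mem_image.mp hw
      rw [Finset.mem_range] at hr
      have hle := rootCountA_le n k
      rw [rootCountA] at hr hle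
      split at hr
      next hkn =>
        have hlen : substLen (k + 1) (tribWord 3) = tribAux (k + 2) := by
          rw [tribWord_three, (substLen_eq _).2.2]
        have h₁ := iterate_blockStart_three (k + 1)
        have h₂ := tribAux_le_bispecialLen k
        have h₃ := bispecialLen_succ k
        have h₄ := tribAux_mono (show k + 6 ≤ n + 5 by omega)
        have h₅ := tribAux_add_three (k + 3)
        have h₆ := tribAux_mono (show k + 2 ≤ k + 3 by omega)
        have h₇ := tribAux_mono (show k + 2 ≤ k + 4 by omega)
        norm_num only [add_assoc] at h₁ h₅
        rw [← hlen]
        exact tribFactor_mem_squareRoots (by omega) (by rw [hlen]; omega)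
      next hkn =>
        have hlen : substLen k (tribWord 0) = tribAux (k + 2) := by
          rw [tribWord_zero, (substLen_eq _).1]
        have h₁ := iterate_blockStart_zero k
        have h₂ := two_mul_bispecialLen k
        have h₃ := tribAux_mono (show k + 4 ≤ n + 5 by omega)
        have h₄ := tribAux_add_three (k + 1)
        have h₅ := tribAux_mono (show k + 1 ≤ k + 3 by omega)
        norm_num only [add_assoc] at h₄
        rw [← hlen]
        exact tribFactor_mem_squareRoots (by omega) (by omega)
    · obtain ⟨r, hr, rfl⟩ := Finset.mem_image.mp hw
      rw [Finset.mem_range, rootCountB] at hr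
      have hlen : substLen k (tribWord 1) = tribAux (k + 1) + tribAux k := by
        rw [tribWord_one, (substLen_eq _).2.1]
      have h₁ := iterate_blockStart_one k
      have h₂ := two_mul_bispecialLen k
      have h₃ := tribAux_mono (show k + 4 ≤ n + 5 by omega)
      have h₄ := tribAux_add_three (k + 1)
      have h₅ := tribAux_add_three k
      have h₆ := tribAux_add_le k
      norm_num only [add_assoc] at h₄
      rw [← hlen]
      exact tribFactor_mem_squareRoots (by omega) (by omega)

theorem A_tribAux (n : ℕ) :
    A (tribAux (n + 5)) =
      ∑ k ∈ Finset.range (n + 2), rootCountA n k + ∑ k ∈ Finset.range (n + 2), rootCountB k := by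
  rw [A_eq_ncard, squareRoots_tribAux, Set.ncard_coe_finset, Finset.card_union_of_disjoint,
    Finset.card_biUnion, Finset.card_biUnion]
  · simp only [card_rootsA, card_rootsB]
  · intro k _ l _ hkl
    refine Finset.disjoint_left.mpr fun w hk hl => ?_
    exact hkl (tribAux_add_strictMono.injective
      ((length_of_mem_rootsB hk).symm.trans (length_of_mem_rootsB hl)))
  · intro k _ l _ hkl
    refine Finset.disjoint_left.mpr fun w hk hl => ?_
    exact hkl (tribAux_add_two_strictMono.injective
      ((length_of_mem_rootsA hk).symm.trans (length_of_mem_rootsA hl)))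
  · simp only [Finset.disjoint_biUnion_left, Finset.disjoint_biUnion_right]
    exact fun k _ l _ => disjoint_rootsA_rootsB n l k

theorem sum_tribAux (n : ℕ) : ∑ k ∈ Finset.range n, tribAux (k + 2) = bispecialLen n := by
  induction n with
  | zero => rfl
  | succ n ih => rw [Finset.sum_range_succ, ih, bispecialLen_succ]

theorem sum_rootCountB (n : ℕ) :
    2 * ∑ k ∈ Finset.range (n + 2), rootCountB k + n + 3 = tribAux (n + 3) + tribAux (n + 2) := by
  induction n with
  | zero => decide
  | succ n ih =>
    have h₁ := two_mul_bispecialLen (n + 2)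
    have h₂ := tribAux_add_three n
    have h₃ := tribAux_add_three (n + 1)
    have h₄ := tribAux_add_three (n + 2)
    have h₅ := tribAux_succ_pos n
    have h₆ := tribAux_succ_pos (n + 1)
    rw [show n + 1 + 2 = n + 2 + 1 by omega, Finset.sum_range_succ, rootCountB]
    norm_num only [add_assoc] at *
    omega

theorem two_mul_A_tribAux (n : ℕ) :
    2 * A (tribAux (n + 5)) + n + 8 =
      2 * tribAux (n + 3) + tribAux (n + 2) + 3 * tribAux (n + 1) := by
  have hsum : ∑ k ∈ Finset.range n, rootCountA n k = bispecialLen n := by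
    rw [← sum_tribAux]
    exact Finset.sum_congr rfl fun k hk => if_pos (Finset.mem_range.mp hk)
  have hA₁ : rootCountA n n = bispecialLen n + 1 - tribAux (n + 2) := if_neg (by omega)
  have hA₂ : rootCountA n (n + 1) = bispecialLen (n + 1) + 1 - tribAux (n + 3) :=
    if_neg (by omega)
  have h₁ := two_mul_bispecialLen n
  have h₂ := two_mul_bispecialLen (n + 1)
  have h₃ := tribAux_le_bispecialLen n
  have h₄ := tribAux_le_bispecialLen (n + 1)
  have h₅ := sum_rootCountB n
  have h₆ := tribAux_add_three n
  have h₇ := tribAux_add_three (n + 1)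
  rw [A_tribAux, Finset.sum_range_succ _ (n + 1), Finset.sum_range_succ _ n, hsum, hA₁, hA₂]
  norm_num only [add_assoc] at *
  omega

theorem A_eq_zero_of_le_four {N : ℕ} (hN : N ≤ 4) : A N = 0 := by
  rw [A_eq_ncard]
  convert Set.ncard_empty (List TLetter)
  refine Set.eq_empty_of_forall_notMem fun w hw => ?_
  obtain ⟨i, p, hp, hle, h, -⟩ := mem_squareRoots_iff.mp hw
  have h₀ := h 0 hp
  have : p = 1 ∧ i = 0 ∨ p = 1 ∧ i = 1 ∨ p = 1 ∧ i = 2 ∨ p = 2 ∧ i = 0 := by omega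
  rcases this with ⟨rfl, rfl⟩ | ⟨rfl, rfl⟩ | ⟨rfl, rfl⟩ | ⟨rfl, rfl⟩
  · simp [tribWord_zero, tribWord_one] at h₀
  · simp [tribWord_one, tribWord_two] at h₀
  · simp [tribWord_two, tribWord_three] at h₀
  · have h₁ := h 1 (by omega)
    simp [tribWord_one, tribWord_three] at h₁

theorem distinct_squares_at_tribonacci :
    (∀ m : ℤ, 0 ≤ m → m ≤ 2 → A (t m) = 0) ∧
    (∀ m : ℤ, 3 ≤ m →
      (A (t m) : ℚ) = (2 * (t (m - 2) : ℚ) + (t (m - 3) : ℚ) + 3 * (t (m - 4) : ℚ)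
        - (m : ℚ) - 5) / 2) := by
  constructor
  · intro m _ h₂
    exact A_eq_zero_of_le_four
      (tribAux_mono (show (m + 2).toNat ≤ 4 by omega))
  · intro m hm
    obtain ⟨n, rfl⟩ : ∃ n : ℕ, m = n + 3 := ⟨(m - 3).toNat, by omega⟩
    have h₀ : t (n + 3) = tribAux (n + 5) := by rw [t]; congr 1
    have h₁ : t (n + 3 - 2) = tribAux (n + 3) := by rw [t]; congr 1; omega
    have h₂ : t (n + 3 - 3) = tribAux (n + 2) := by rw [t]; congr 1; omega
    have h₃ : t (n + 3 - 4) = tribAux (n + 1) := by rw [t]; congr 1; omega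
    have h := congrArg (Nat.cast : ℕ → ℚ) (two_mul_A_tribAux n)
    rw [h₀, h₁, h₂, h₃]
    push_cast at h ⊢
    linarith
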